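/- arXiv:2410.18922 — 2 statements merged into one kernel-verified Lean document; each statement's English description precedes it below -/
import Mathlib

section
/- For every nonempty finite subset T of a finite type U and all distinct x, y ∈ U, the total probability of a non-⊥ outcome of the pair query satisfies |⟨v₊, ψ_T⟩|² + |⟨v₋, ψ_T⟩|² = |{x, y} ∩ T| / |T|. -/
open scoped InnerProductSpace

/-- `ψ_T = (1/√|T|) · ∑_{t∈T} e_t` in `ℂ^U`. -/
noncomputable def psi {U : Type*} [Fintype U] [DecidableEq U] (T : Finset U) :
    EuclideanSpace ℂ U :=
  ((Real.sqrt T.card : ℂ))⁻¹ • ∑ t ∈ T, EuclideanSpace.single t (1 : ℂ)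

/-- `v₊ = (e_x + e_y)/√2`. -/
noncomputable def vplus {U : Type*} [Fintype U] [DecidableEq U] (x y : U) :
    EuclideanSpace ℂ U :=
  ((Real.sqrt 2 : ℂ))⁻¹ • (EuclideanSpace.single x (1 : ℂ) + EuclideanSpace.single y (1 : ℂ))

/-- `v₋ = (e_x − e_y)/√2`. -/
noncomputable def vminus {U : Type*} [Fintype U] [DecidableEq U] (x y : U) :
    EuclideanSpace ℂ U :=
  ((Real.sqrt 2 : ℂ))⁻¹ • (EuclideanSpace.single x (1 : ℂ) - EuclideanSpace.single y (1 : ℂ))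

theorem psi_apply {U : Type*} [Fintype U] [DecidableEq U] (T : Finset U) (u : U) :
    psi T u = if u ∈ T then ((Real.sqrt T.card : ℂ))⁻¹ else 0 := by
  simp [psi, Pi.single_apply]

theorem inner_vplus {U : Type*} [Fintype U] [DecidableEq U] (x y : U)
    (w : EuclideanSpace ℂ U) :
    ⟪vplus x y, w⟫_ℂ = ((Real.sqrt 2 : ℂ))⁻¹ * (w x + w y) := by
  simp [vplus, EuclideanSpace.inner_single_left]
  ring

theorem inner_vminus {U : Type*} [Fintype U] [DecidableEq U] (x y : U)
    (w : EuclideanSpace ℂ U) :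
    ⟪vminus x y, w⟫_ℂ = ((Real.sqrt 2 : ℂ))⁻¹ * (w x - w y) := by
  simp [vminus, EuclideanSpace.inner_single_left]
  ring

theorem norm_psi_apply_sq {U : Type*} [Fintype U] [DecidableEq U] (T : Finset U) (u : U) :
    ‖psi T u‖ ^ 2 = if u ∈ T then ((T.card : ℝ))⁻¹ else 0 := by
  rw [psi_apply]
  split_ifs <;> simp

/-- The total weight of `w` along `v₊` and `v₋` equals its weight along `e_x` and `e_y`. -/
theorem norm_inner_vplus_sq_add_norm_inner_vminus_sq {U : Type*} [Fintype U] [DecidableEq U]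
    (x y : U) (w : EuclideanSpace ℂ U) :
    ‖⟪vplus x y, w⟫_ℂ‖ ^ 2 + ‖⟪vminus x y, w⟫_ℂ‖ ^ 2 = ‖w x‖ ^ 2 + ‖w y‖ ^ 2 := by
  have h2 : ‖((Real.sqrt 2 : ℂ))⁻¹‖ ^ 2 = 2⁻¹ := by simp
  have hp := parallelogram_law_with_norm ℂ (w x) (w y)
  rw [inner_vplus, inner_vminus, norm_mul, norm_mul, mul_pow, mul_pow, h2]
  linarith

/-- Total probability of a non-`⊥` outcome of the pair query:
`|⟨v₊, ψ_T⟩|² + |⟨v₋, ψ_T⟩|² = |{x,y} ∩ T|/|T|`. -/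
theorem inner_vpm_psi_total {U : Type*} [Fintype U] [DecidableEq U] (T : Finset U)
    (hT : T.Nonempty) (x y : U) (hxy : x ≠ y) :
    ‖⟪vplus x y, psi T⟫_ℂ‖ ^ 2 + ‖⟪vminus x y, psi T⟫_ℂ‖ ^ 2
      = ((({x, y} : Finset U) ∩ T).card : ℝ) / (T.card : ℝ) := by
  rw [norm_inner_vplus_sq_add_norm_inner_vminus_sq, norm_psi_apply_sq, norm_psi_apply_sq]
  by_cases hx : x ∈ T <;> by_cases hy : y ∈ T <;>
    simp [hx, hy, hxy]
  ring
end

section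
/- Let T be a finite subset of a finite type U with distinct elements x, y ∈ U such that {x, y} ⊆ T and |T| ≥ 3. Then ψ_T − ⟨v₊, ψ_T⟩ v₊ − ⟨v₋, ψ_T⟩ v₋ = √((|T|−2)/|T|) · ψ_{T \ {x,y}}; in particular, normalizing this residual yields exactly ψ_{T \ {x,y}}. -/
open scoped InnerProductSpace

theorem norm_psi {U : Type*} [Fintype U] [DecidableEq U] {T : Finset U} (hT : T.Nonempty) :
    ‖psi T‖ = 1 := by
  have hc : (T.card : ℝ) ≠ 0 := by exact_mod_cast hT.card_ne_zero
  rw [EuclideanSpace.norm_eq, Real.sqrt_eq_one]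
  simp [psi_apply, apply_ite, ite_pow, hc]

theorem inv_sqrt_two_mul_self : ((Real.sqrt 2 : ℂ))⁻¹ * ((Real.sqrt 2 : ℂ))⁻¹ = 2⁻¹ := by
  rw [← mul_inv, ← Complex.ofReal_mul, Real.mul_self_sqrt zero_le_two, Complex.ofReal_ofNat]

/-- The projections onto `v₊` and `v₋` add up to the projection onto the span of `e_x, e_y`. -/
theorem inner_vplus_smul_add_inner_vminus_smul {U : Type*} [Fintype U] [DecidableEq U]
    (x y : U) (v : EuclideanSpace ℂ U) :
    ⟪vplus x y, v⟫_ℂ • vplus x y + ⟪vminus x y, v⟫_ℂ • vminus x y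
      = EuclideanSpace.single x (v x) + EuclideanSpace.single y (v y) := by
  have hp : ⟪vplus x y, v⟫_ℂ = ((Real.sqrt 2 : ℂ))⁻¹ * (v x + v y) := by
    rw [vplus, inner_smul_left, inner_add_left]
    simp [EuclideanSpace.inner_single_left]
  have hm : ⟪vminus x y, v⟫_ℂ = ((Real.sqrt 2 : ℂ))⁻¹ * (v x - v y) := by
    rw [vminus, inner_smul_left, inner_sub_left]
    simp [EuclideanSpace.inner_single_left]
  have hs (i : U) (a : ℂ) : EuclideanSpace.single i a = a • EuclideanSpace.single i (1 : ℂ) := by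
    ext; simp [PiLp.single_apply]
  rw [hp, hm, hs x (v x), hs y (v y), vplus, vminus]
  match_scalars
  · linear_combination (2 * v x) * inv_sqrt_two_mul_self
  · linear_combination (2 * v y) * inv_sqrt_two_mul_self

/-- Removing two coordinates of `T` from `ψ_T` rescales the sketch vector of the rest. -/
theorem psi_sub_single_add_single {U : Type*} [Fintype U] [DecidableEq U] {T : Finset U}
    {x y : U} (hxy : x ≠ y) (hx : x ∈ T) (hy : y ∈ T) (hT : 3 ≤ T.card) :
    psi T - (EuclideanSpace.single x (psi T x) + EuclideanSpace.single y (psi T y))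
      = ((Real.sqrt (((T.card : ℝ) - 2) / (T.card : ℝ)) : ℂ)) • psi (T \ {x, y}) := by
  have hsub : ({x, y} : Finset U) ⊆ T := by simp [Finset.insert_subset_iff, hx, hy]
  have hcard : ((T \ {x, y}).card : ℝ) = (T.card : ℝ) - 2 := by
    rw [Finset.card_sdiff_of_subset hsub, Finset.card_pair hxy, Nat.cast_sub (by omega),
      Nat.cast_ofNat]
  have hT' : (3 : ℝ) ≤ T.card := by exact_mod_cast hT
  have hpos : (0 : ℝ) < (T.card : ℝ) - 2 := by linarith
  have hne : (Real.sqrt ((T.card : ℝ) - 2) : ℂ) ≠ 0 := by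
    exact_mod_cast (Real.sqrt_pos.2 hpos).ne'
  ext u
  by_cases hux : u = x
  · subst hux
    simp [psi_apply, hxy]
  by_cases huy : u = y
  · subst huy
    simp [psi_apply, hux]
  by_cases hu : u ∈ T
  · simp only [PiLp.sub_apply, PiLp.add_apply, PiLp.smul_apply, psi_apply, PiLp.single_apply,
      hux, huy, hu, hcard, Real.sqrt_div hpos.le, Finset.mem_sdiff, Finset.mem_insert,
      Finset.mem_singleton, smul_eq_mul, Complex.ofReal_div]
    simp
    field_simp
  · simp [psi_apply, hux, huy, hu]

/-- If `{x, y} ⊆ T`, `x ≠ y`, and `|T| ≥ 3`, then the residual of `ψ_T` after projecting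
away the spans of `v₊` and `v₋` equals `√((|T|−2)/|T|) · ψ_{T \ {x,y}}`; in particular,
normalizing it yields `ψ_{T \ {x,y}}`. -/
theorem psi_residual_pair_both_mem {U : Type*} [Fintype U] [DecidableEq U] (T : Finset U)
    (x y : U) (hxy : x ≠ y) (hx : x ∈ T) (hy : y ∈ T) (hT : 3 ≤ T.card) :
    psi T - ⟪vplus x y, psi T⟫_ℂ • vplus x y - ⟪vminus x y, psi T⟫_ℂ • vminus x y
        = ((Real.sqrt (((T.card : ℝ) - 2) / (T.card : ℝ)) : ℂ)) • psi (T \ {x, y}) ∧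
      ‖psi T - ⟪vplus x y, psi T⟫_ℂ • vplus x y - ⟪vminus x y, psi T⟫_ℂ • vminus x y‖⁻¹ •
          (psi T - ⟪vplus x y, psi T⟫_ℂ • vplus x y - ⟪vminus x y, psi T⟫_ℂ • vminus x y)
        = psi (T \ {x, y}) := by
  have hres : psi T - ⟪vplus x y, psi T⟫_ℂ • vplus x y - ⟪vminus x y, psi T⟫_ℂ • vminus x y
      = ((Real.sqrt (((T.card : ℝ) - 2) / (T.card : ℝ)) : ℂ)) • psi (T \ {x, y}) := by
    rw [sub_sub, inner_vplus_smul_add_inner_vminus_smul, psi_sub_single_add_single hxy hx hy hT]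
  refine ⟨hres, ?_⟩
  have hT' : (3 : ℝ) ≤ T.card := by exact_mod_cast hT
  have hpos : 0 < Real.sqrt (((T.card : ℝ) - 2) / (T.card : ℝ)) :=
    Real.sqrt_pos.2 (div_pos (by linarith) (by linarith))
  have hne : (T \ {x, y}).Nonempty := by
    rw [Finset.sdiff_nonempty]
    intro h
    have := (Finset.card_le_card h).trans Finset.card_le_two
    omega
  rw [hres, Complex.coe_smul, norm_smul, norm_psi hne, mul_one, Real.norm_of_nonneg hpos.le,
    inv_smul_smul₀ hpos.ne']
end
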